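/- Assume g satisfies conditions (2.4) and h satisfies conditions (2.5), and let N = 2. Given t₀ ≥ 0, let φ be the solution on its maximal interval (t₀, t₁) of the ODE (t g(φ(t)²) φ(t))' = t h(φ(t)²) with φ(t₀) = 0, and let ψ : (0,∞) → (t₀, t₁) be the inverse function of φ. Let Ω ⊂ ℝ² be a bounded open set and let u be a C³ function on Ω, with u and ∇u continuous on the closure of Ω, solving Σ_{i=1}^2 ∂_i(g(q²) ∂_i u) = h(q²) in Ω, where q = |∇u|, and with q(x) > 0 for all x in the closure of Ω. Then the function Φ(x) = ∫₀^{q(x)} s ψ'(s) ds − u(x) attains both its maximum and its minimum over the closure of Ω at points of the boundary ∂Ω. -/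

import Mathlib

open Set Filter

noncomputable section

/-- `G(ξ) = g(ξ) + 2ξ g'(ξ)`, from (1.2). -/
def Gfun (g : ℝ → ℝ) (ξ : ℝ) : ℝ := g ξ + 2 * ξ * deriv g ξ

/-- Conditions (2.4) on `g`. -/
def Cond24 (g : ℝ → ℝ) : Prop :=
  ContDiffOn ℝ (⊤ : ℕ∞) g (Ioi 0) ∧ (∀ ξ > (0:ℝ), 0 < g ξ) ∧
  Tendsto (fun ξ : ℝ => g (ξ ^ 2) * ξ) (nhdsWithin 0 (Ioi 0)) (nhds 0) ∧
  Tendsto (fun ξ : ℝ => g (ξ ^ 2) * ξ) atTop atTop ∧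
  (∀ ξ > (0:ℝ), 0 < Gfun g ξ)

/-- Conditions (2.5) on `h`. -/
def Cond25 (h : ℝ → ℝ) : Prop :=
  ContDiffOn ℝ (⊤ : ℕ∞) h (Ici 0) ∧ (∀ ξ ≥ (0:ℝ), 0 < h ξ) ∧
  (∀ ξ ≥ (0:ℝ), 0 ≤ derivWithin h (Ici 0) ξ)

/-- `φ` is a (differentiable) solution of the ODE (2.6) (with `N = 2`) on `s`. -/
def SolOn (N : ℕ) (g h φ : ℝ → ℝ) (s : Set ℝ) : Prop :=
  DifferentiableOn ℝ φ s ∧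
  ∀ t ∈ s, HasDerivAt (fun τ : ℝ => τ ^ (N - 1) * (g (φ τ ^ 2) * φ τ))
    (t ^ (N - 1) * h (φ t ^ 2)) t

/-- The open interval `(t₀, t₁)` where `t₁` may be `∞` (an extended real). -/
def Iint (t₀ : ℝ) (t₁ : EReal) : Set ℝ := {t : ℝ | t₀ < t ∧ (t : EReal) < t₁}

/-- The `i`-th standard basis vector of `ℝ²`. -/
def eb (i : Fin 2) : EuclideanSpace ℝ (Fin 2) := EuclideanSpace.single i 1

/-- The second derivative is nonpositive at an interior maximum. -/
lemma deriv_deriv_nonpos_of_isLocalMax {f f' : ℝ → ℝ} {c a : ℝ}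
    (hf : ∀ᶠ t in nhds a, HasDerivAt f (f' t) t) (hf' : HasDerivAt f' c a)
    (hmax : IsLocalMax f a) : c ≤ 0 := by
  by_contra! hc
  have hd : deriv f =ᶠ[nhds a] f' := hf.mono fun t ht => ht.deriv
  have hdd : deriv (deriv f) a = c := by rw [hd.deriv_eq, hf'.deriv]
  have hmin : IsLocalMin f a :=
    isLocalMin_of_deriv_deriv_pos (by rw [hdd]; exact hc) hmax.deriv_eq_zero
      hf.self_of_nhds.continuousAt
  have hconst : f =ᶠ[nhds a] fun _ => f a := by
    filter_upwards [hmin, hmax] with t h1 h2 using le_antisymm h2 h1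
  have : deriv (deriv f) a = 0 := by rw [hconst.deriv.deriv_eq]; simp
  linarith

/-- The weak maximum principle for a linear elliptic equation without zeroth-order term, in a
bounded planar open set. -/
lemma exists_frontier_isMaxOn {Ω : Set (EuclideanSpace ℝ (Fin 2))}
    (hΩ : IsOpen Ω) (hbdd : Bornology.IsBounded Ω) (hne : Ω.Nonempty)
    {Φ φ0 φ1 : EuclideanSpace ℝ (Fin 2) → ℝ} (hΦ : ContinuousOn Φ (closure Ω))
    (hΦd : ∀ x ∈ Ω, DifferentiableAt ℝ Φ x)
    (hΦ0 : ∀ x ∈ Ω, fderiv ℝ Φ x (eb 0) = φ0 x) (hΦ1 : ∀ x ∈ Ω, fderiv ℝ Φ x (eb 1) = φ1 x)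
    (hφ0 : ∀ x ∈ Ω, DifferentiableAt ℝ φ0 x) (hφ1 : ∀ x ∈ Ω, DifferentiableAt ℝ φ1 x)
    {a b c d e : EuclideanSpace ℝ (Fin 2) → ℝ}
    (ha : ∀ x ∈ Ω, 0 < a x) (hdet : ∀ x ∈ Ω, 0 ≤ a x * c x - b x ^ 2)
    (hac : ContinuousOn a Ω) (hdc : ContinuousOn d Ω)
    (heq : ∀ x ∈ Ω, a x * fderiv ℝ φ0 x (eb 0) +
      b x * (fderiv ℝ φ1 x (eb 0) + fderiv ℝ φ0 x (eb 1)) + c x * fderiv ℝ φ1 x (eb 1) =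
      d x * φ0 x + e x * φ1 x) :
    ∃ x₀ ∈ frontier Ω, ∀ x ∈ closure Ω, Φ x ≤ Φ x₀ := by
  have hcomp : IsCompact (closure Ω) := hbdd.isCompact_closure
  obtain ⟨z₀, hz₀, hmax⟩ := hcomp.exists_isMaxOn hne.closure hΦ
  by_contra! hno
  have hfr : ∃ m < Φ z₀, ∀ x ∈ frontier Ω, Φ x ≤ m := by
    have hfc : IsCompact (frontier Ω) := hcomp.of_isClosed_subset isClosed_frontier
      frontier_subset_closure
    rcases (frontier Ω).eq_empty_or_nonempty with h | h
    · exact ⟨Φ z₀ - 1, by linarith, by simp [h]⟩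
    · obtain ⟨y, hy, hymax⟩ := hfc.exists_isMaxOn h (hΦ.mono frontier_subset_closure)
      obtain ⟨x, hx, hlt⟩ := hno y hy
      exact ⟨Φ y, hlt.trans_le (hmax hx), hymax⟩
  obtain ⟨m, hm, hfr⟩ := hfr
  set K : Set (EuclideanSpace ℝ (Fin 2)) := closure Ω ∩ Φ ⁻¹' Ici ((m + Φ z₀) / 2) with hK
  have hKc : IsCompact K := hcomp.of_isClosed_subset
    (hΦ.preimage_isClosed_of_isClosed isClosed_closure isClosed_Ici) inter_subset_left
  have hin : ∀ x ∈ closure Ω, m < Φ x → x ∈ Ω := by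
    intro x hx h
    by_contra hxΩ
    exact absurd (hfr x ⟨hx, by rwa [hΩ.interior_eq]⟩) (not_le.2 h)
  have hKΩ : K ⊆ Ω := fun x hx => hin x hx.1 (by have := hx.2; simp at this; linarith)
  obtain ⟨C, hC⟩ := hKc.bddAbove_image ((hdc.div hac fun x hx => (ha x hx).ne').mono hKΩ)
  set l : ℝ := max C 0 + 1 with hl
  have hl0 : 0 < l := by positivity
  have hlK : ∀ x ∈ K, d x < l * a x := by
    intro x hx
    have h1 : d x / a x ≤ C := hC (mem_image_of_mem _ hx)
    have h2 : d x / a x < l := by have := le_max_left C 0; linarith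
    rwa [div_lt_iff₀ (ha x (hKΩ hx))] at h2
  set E : EuclideanSpace ℝ (Fin 2) → ℝ := fun x => Real.exp (l * x 0) with hE
  have hEc : Continuous E := by fun_prop
  obtain ⟨B, hB⟩ := hcomp.bddAbove_image hEc.continuousOn
  have hB' : ∀ x ∈ closure Ω, E x ≤ B := fun x hx => hB (mem_image_of_mem _ hx)
  have hB0 : 0 < B := (Real.exp_pos _).trans_le (hB' z₀ hz₀)
  set ε : ℝ := (Φ z₀ - m) / (2 * B) with hε
  have hε0 : 0 < ε := div_pos (by linarith) (by linarith)
  have hεB : ε * B = (Φ z₀ - m) / 2 := by rw [hε]; field_simp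
  obtain ⟨z, hz, hzmax⟩ := hcomp.exists_isMaxOn hne.closure
    (hΦ.add (hEc.continuousOn.const_smul ε))
  have hzK : z ∈ K := by
    refine ⟨hz, ?_⟩
    have h1 : Φ z₀ + ε * E z₀ ≤ Φ z + ε * E z := hzmax hz₀
    have h2 : ε * E z ≤ ε * B := mul_le_mul_of_nonneg_left (hB' z hz) hε0.le
    have h3 : 0 < ε * E z₀ := mul_pos hε0 (Real.exp_pos _)
    simp only [mem_preimage, mem_Ici]
    linarith
  have hzΩ := hKΩ hzK
  have hloc : IsLocalMax (fun x => Φ x + ε * E x) z := by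
    filter_upwards [hΩ.mem_nhds hzΩ] with x hx using hzmax (subset_closure hx)
  have hline : ∀ α β t : ℝ, HasDerivAt (fun t : ℝ => z + t • (α • eb 0 + β • eb 1))
      (α • eb 0 + β • eb 1) t := by
    intro α β t
    simpa using ((hasDerivAt_id t).smul_const (α • eb 0 + β • eb 1)).const_add z
  have hEline : ∀ α β t : ℝ, HasDerivAt
      (fun t : ℝ => E (z + t • (α • eb 0 + β • eb 1)))
      (α * (l * E (z + t • (α • eb 0 + β • eb 1)))) t := by
    intro α β t
    have h : (fun t : ℝ => E (z + t • (α • eb 0 + β • eb 1))) =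
        fun t => Real.exp (l * (z 0 + t * α)) := by
      funext t; simp [hE, eb]
    have h' : E (z + t • (α • eb 0 + β • eb 1)) = Real.exp (l * (z 0 + t * α)) := congrFun h t
    rw [h, h']
    convert ((((hasDerivAt_id' t).mul_const α).const_add (z 0)).const_mul l).exp using 1
    ring
  have hev : ∀ α β : ℝ, ∀ᶠ t : ℝ in nhds 0, z + t • (α • eb 0 + β • eb 1) ∈ Ω := by
    intro α β
    refine (hline α β 0).continuousAt.eventually_mem (hΩ.mem_nhds ?_)
    simpa using hzΩ
  have hd1 : ∀ α β : ℝ, ∀ᶠ t : ℝ in nhds 0, HasDerivAt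
      (fun t : ℝ => Φ (z + t • (α • eb 0 + β • eb 1)) +
        ε * E (z + t • (α • eb 0 + β • eb 1)))
      ((α * φ0 (z + t • (α • eb 0 + β • eb 1)) + β * φ1 (z + t • (α • eb 0 + β • eb 1))) +
        ε * (α * (l * E (z + t • (α • eb 0 + β • eb 1))))) t := by
    intro α β
    filter_upwards [hev α β] with t ht
    have := ((hΦd _ ht).hasFDerivAt.comp_hasDerivAt t (hline α β t)).add
      ((hEline α β t).const_mul ε)
    rw [map_add, map_smul, map_smul, hΦ0 _ ht, hΦ1 _ ht] at this
    exact this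
  have hlm : ∀ α β : ℝ, IsLocalMax (fun t : ℝ => Φ (z + t • (α • eb 0 + β • eb 1)) +
        ε * E (z + t • (α • eb 0 + β • eb 1))) 0 := by
    intro α β
    have hc := (hline α β 0).continuousAt
    have hloc' : IsLocalMax (fun x => Φ x + ε * E x) (z + (0 : ℝ) • (α • eb 0 + β • eb 1)) := by
      simpa using hloc
    exact hc.eventually hloc'
  have hq : ∀ α β : ℝ, α ^ 2 * (fderiv ℝ φ0 z (eb 0) + ε * l ^ 2 * E z) +
      α * β * (fderiv ℝ φ1 z (eb 0) + fderiv ℝ φ0 z (eb 1)) +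
      β ^ 2 * fderiv ℝ φ1 z (eb 1) ≤ 0 := by
    intro α β
    have hz0 : z + (0 : ℝ) • (α • eb 0 + β • eb 1) = z := by simp
    have h0 := (hz0.symm ▸ hφ0 z hzΩ).hasFDerivAt.comp_hasDerivAt (0 : ℝ) (hline α β 0)
    have h1 := (hz0.symm ▸ hφ1 z hzΩ).hasFDerivAt.comp_hasDerivAt (0 : ℝ) (hline α β 0)
    have := deriv_deriv_nonpos_of_isLocalMax (hd1 α β)
      (((h0.const_mul α).add (h1.const_mul β)).add
        ((((hEline α β 0).const_mul l).const_mul α).const_mul ε)) (hlm α β)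
    simp only [hz0, map_add, map_smul, smul_eq_mul] at this
    linarith
  have hg : ∀ α β : ℝ, α * φ0 z + β * φ1 z + ε * (α * (l * E z)) = 0 := by
    intro α β
    have := (hlm α β).hasDerivAt_eq_zero (hd1 α β).self_of_nhds
    simpa using this
  have g0 := hg 1 0
  have g1 := hg 0 1
  have hq1 := hq (a z) (b z)
  have hq2 := hq 0 1
  have hpos := ha z hzΩ
  have hprod : a z * (a z * fderiv ℝ φ0 z (eb 0) +
      b z * (fderiv ℝ φ1 z (eb 0) + fderiv ℝ φ0 z (eb 1)) + c z * fderiv ℝ φ1 z (eb 1) +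
      a z * (ε * l ^ 2 * E z)) ≤ 0 := by
    have := mul_nonpos_of_nonneg_of_nonpos (hdet z hzΩ) hq2
    linarith
  have htr := nonpos_of_mul_nonpos_right hprod hpos
  rw [heq z hzΩ] at htr
  have hφ0z : φ0 z = -(ε * l * E z) := by linarith
  have hφ1z : φ1 z = 0 := by linarith
  rw [hφ0z, hφ1z] at htr
  have : 0 < ε * l * E z * (l * a z - d z) :=
    mul_pos (mul_pos (mul_pos hε0 hl0) (Real.exp_pos _)) (sub_pos.2 (hlK z hzK))
  linarith

lemma isOpen_Iint (t₀ : ℝ) (t₁ : EReal) : IsOpen (Iint t₀ t₁) :=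
  (isOpen_lt continuous_const continuous_id).inter
    (isOpen_lt continuous_coe_real_ereal continuous_const)

lemma Cond24.hasDerivAt_mul_id {g : ℝ → ℝ} (hg : Cond24 g) {s : ℝ} (hs : 0 < s) :
    HasDerivAt (fun s => g (s ^ 2) * s) (Gfun g (s ^ 2)) s := by
  have hs2 : 0 < s ^ 2 := by positivity
  have hd : HasDerivAt g (deriv g (s ^ 2)) (s ^ 2) :=
    ((hg.1.contDiffAt (Ioi_mem_nhds hs2)).differentiableAt (by simp)).hasDerivAt
  have hp : HasDerivAt (fun s : ℝ => s ^ 2) (2 * s) s := by simpa using hasDerivAt_pow 2 s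
  have := (HasDerivAt.comp (h₂ := g) (h := fun s => s ^ 2) s hd hp).mul (hasDerivAt_id' s)
  refine this.congr_deriv ?_
  simp only [Gfun, Function.comp]
  ring

lemma Cond25.monotoneOn {h : ℝ → ℝ} (hh : Cond25 h) : MonotoneOn h (Ici 0) := by
  refine monotoneOn_of_deriv_nonneg (convex_Ici 0) hh.1.continuousOn
    ((hh.1.differentiableOn (by simp)).mono interior_subset) fun x hx => ?_
  rw [interior_Ici] at hx
  rw [← derivWithin_of_mem_nhds (Ici_mem_nhds hx)]
  exact hh.2.2 x hx.le

section Radial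

variable {g h : ℝ → ℝ} {t₀ : ℝ} {t₁ : EReal} {φ ψ : ℝ → ℝ}

/-- The flux of the radial solution is less than `t * h`. -/
lemma flux_lt (hg : Cond24 g) (hh : Cond25 h) (ht₀ : 0 ≤ t₀)
    (hsol : SolOn 2 g h φ (Iint t₀ t₁))
    (hcont₀ : Tendsto φ (nhdsWithin t₀ (Ioi t₀)) (nhds 0))
    (hmono : StrictMonoOn φ (Iint t₀ t₁)) (hpos : ∀ t ∈ Iint t₀ t₁, 0 < φ t)
    {t : ℝ} (ht : t ∈ Iint t₀ t₁) :
    g (φ t ^ 2) * φ t < t * h (φ t ^ 2) := by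
  have hsub : ∀ τ ∈ Ioc t₀ t, τ ∈ Iint t₀ t₁ := fun τ hτ =>
    ⟨hτ.1, (EReal.coe_le_coe_iff.2 hτ.2).trans_lt ht.2⟩
  have htpos : 0 < t := ht₀.trans_lt ht.1
  have hder : ∀ τ ∈ Ioc t₀ t, HasDerivAt
      (fun τ => τ * (g (φ τ ^ 2) * φ τ) - h (φ t ^ 2) * τ ^ 2 / 2)
      (τ * h (φ τ ^ 2) - h (φ t ^ 2) * τ) τ := by
    intro τ hτ
    have h1 := hsol.2 τ (hsub τ hτ)
    simp only [Nat.add_one_sub_one, pow_one] at h1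
    refine (h1.sub (((hasDerivAt_pow 2 τ).const_mul (h (φ t ^ 2))).div_const 2)).congr_deriv ?_
    simp; ring
  have hanti : AntitoneOn (fun τ => τ * (g (φ τ ^ 2) * φ τ) - h (φ t ^ 2) * τ ^ 2 / 2)
      (Ioc t₀ t) := by
    refine antitoneOn_of_deriv_nonpos (convex_Ioc _ _)
      (fun τ hτ => (hder τ hτ).continuousAt.continuousWithinAt)
      (fun τ hτ => (hder τ (interior_subset hτ)).differentiableAt.differentiableWithinAt)
      fun τ hτ => ?_
    have hτ' := interior_subset hτ
    rw [(hder τ hτ').deriv]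
    have hle : φ τ ≤ φ t := hmono.monotoneOn (hsub τ hτ') ht hτ'.2
    have h0 := hpos τ (hsub τ hτ')
    have : h (φ τ ^ 2) ≤ h (φ t ^ 2) :=
      hh.monotoneOn (mem_Ici.2 (sq_nonneg _)) (mem_Ici.2 (sq_nonneg _))
        (pow_le_pow_left₀ h0.le hle 2)
    have hτ0 : 0 ≤ τ := ht₀.trans hτ'.1.le
    nlinarith
  have hφlim : Tendsto φ (nhdsWithin t₀ (Ioi t₀)) (nhdsWithin 0 (Ioi 0)) := by
    refine tendsto_nhdsWithin_iff.2 ⟨hcont₀, ?_⟩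
    filter_upwards [Ioc_mem_nhdsGT ht.1] with τ hτ using hpos τ (hsub τ hτ)
  have hid : Tendsto (fun τ : ℝ => τ) (nhdsWithin t₀ (Ioi t₀)) (nhds t₀) :=
    tendsto_id.mono_left nhdsWithin_le_nhds
  have hlim : Tendsto (fun τ => τ * (g (φ τ ^ 2) * φ τ) - h (φ t ^ 2) * τ ^ 2 / 2)
      (nhdsWithin t₀ (Ioi t₀)) (nhds (t₀ * 0 - h (φ t ^ 2) * t₀ ^ 2 / 2)) :=
    (hid.mul (hg.2.2.1.comp hφlim)).sub (((hid.pow 2).const_mul _).div_const 2)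
  have hle : t * (g (φ t ^ 2) * φ t) - h (φ t ^ 2) * t ^ 2 / 2 ≤
      t₀ * 0 - h (φ t ^ 2) * t₀ ^ 2 / 2 := by
    refine ge_of_tendsto hlim ?_
    filter_upwards [Ioc_mem_nhdsGT ht.1] with τ hτ using hanti hτ ⟨ht.1, le_rfl⟩ hτ.2
  have hhpos := hh.2.1 (φ t ^ 2) (sq_nonneg _)
  have h1 : 0 ≤ h (φ t ^ 2) * t₀ ^ 2 / 2 := by positivity
  have h2 : 0 < h (φ t ^ 2) * t ^ 2 / 2 := by positivity
  refine lt_of_mul_lt_mul_left ?_ htpos.le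
  nlinarith

/-- The derivative of the inverse of the radial solution. -/
lemma hasDerivAt_inverse (hg : Cond24 g) (ht₀ : 0 ≤ t₀)
    (hsol : SolOn 2 g h φ (Iint t₀ t₁))
    (hψmono : MonotoneOn ψ (Ioi 0))
    (hψl : ∀ t ∈ Iint t₀ t₁, ψ (φ t) = t)
    (hψr : ∀ s ∈ Ioi (0 : ℝ), ψ s ∈ Iint t₀ t₁ ∧ φ (ψ s) = s)
    (hpos : ∀ t ∈ Iint t₀ t₁, 0 < φ t)
    (hflux : ∀ t ∈ Iint t₀ t₁, g (φ t ^ 2) * φ t < t * h (φ t ^ 2)) {s : ℝ} (hs : 0 < s) :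
    HasDerivAt ψ (ψ s * Gfun g (s ^ 2) / (ψ s * h (s ^ 2) - g (s ^ 2) * s)) s := by
  have himg : Iint t₀ t₁ ⊆ ψ '' Ioi 0 := fun t ht => ⟨φ t, hpos t ht, hψl t ht⟩
  obtain ⟨hI, hφψ⟩ := hψr s hs
  have hcont : ContinuousAt ψ s := continuousAt_of_monotoneOn_of_image_mem_nhds hψmono
    (Ioi_mem_nhds hs) (mem_of_superset ((isOpen_Iint t₀ t₁).mem_nhds hI) himg)
  have hψ0 : 0 < ψ s := ht₀.trans_lt hI.1
  have hd : HasDerivAt φ (deriv φ (ψ s)) (ψ s) :=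
    ((hsol.1 _ hI).differentiableAt ((isOpen_Iint t₀ t₁).mem_nhds hI)).hasDerivAt
  have hF := hg.hasDerivAt_mul_id hs
  have hfl := hflux _ hI
  have hode := hsol.2 _ hI
  simp only [Nat.add_one_sub_one, pow_one] at hode
  rw [hφψ] at hode hfl
  have hcomp := (hasDerivAt_id' (ψ s)).mul (HasDerivAt.comp (ψ s) (hφψ.symm ▸ hF) hd)
  have huniq := hode.unique hcomp
  simp only [Function.comp, hφψ] at huniq
  have hG := hg.2.2.2.2 (s ^ 2) (by positivity)
  have hval : deriv φ (ψ s) = (ψ s * h (s ^ 2) - g (s ^ 2) * s) / (ψ s * Gfun g (s ^ 2)) := by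
    rw [eq_div_iff (by positivity)]
    linarith
  have hne : deriv φ (ψ s) ≠ 0 := by
    rw [hval]
    exact (div_pos (by linarith) (by positivity)).ne'
  have := HasDerivAt.of_local_left_inverse hcont hd hne
    (by filter_upwards [Ioi_mem_nhds hs] with y hy using (hψr y hy).2)
  rwa [hval, inv_div] at this

end Radial

/-- A monotone function on the positive half-line that is bounded below has a derivative with
locally integrable moment, so that the moment integral is differentiable. -/
lemma hasDerivAt_integral_mul_deriv {ψ m : ℝ → ℝ} {t₀ : ℝ} (hb : ∀ s > 0, t₀ ≤ ψ s)
    (hmono : MonotoneOn ψ (Ioi 0)) (hd : ∀ s > 0, HasDerivAt ψ (m s) s)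
    (hm : ContinuousOn m (Ioi 0)) {s : ℝ} (hs : 0 < s) :
    HasDerivAt (fun r => ∫ s in (0 : ℝ)..r, s * deriv ψ s) (s * m s) s := by
  classical
  set χ : ℝ → ℝ := fun s => if 0 < s then ψ s else t₀ with hχ
  have hχmono : MonotoneOn χ (uIcc 0 s) := by
    intro a _ b _ hab
    simp only [hχ]
    split_ifs with h1 h2 h2
    · exact hmono h1 h2 hab
    · exact absurd (h1.trans_le hab) h2
    · exact hb b h2
    · exact le_rfl
  have hdχ : ∀ r > 0, deriv χ r = deriv ψ r := fun r hr => by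
    refine Filter.EventuallyEq.deriv_eq ?_
    filter_upwards [Ioi_mem_nhds hr] with y hy using if_pos hy
  have hint : IntervalIntegrable (fun s => s * deriv ψ s) MeasureTheory.volume 0 s := by
    have h1 := hχmono.intervalIntegrable_deriv.continuousOn_mul
      (g := fun s => s) continuous_id.continuousOn
    refine h1.congr fun r hr => ?_
    rw [uIoc_of_le hs.le] at hr
    simp [hdχ r hr.1]
  have hcont : ContinuousOn (fun s => s * deriv ψ s) (Ioi 0) :=
    (continuousOn_id.mul hm).congr fun r hr => by simp [(hd r hr).deriv]
  have := intervalIntegral.integral_hasDerivAt_right hint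
    (hcont.stronglyMeasurableAtFilter isOpen_Ioi s hs) (hcont.continuousAt (Ioi_mem_nhds hs))
  rwa [(hd s hs).deriv] at this

/-- The `i`-th partial derivative. -/
def pd (i : Fin 2) (f : EuclideanSpace ℝ (Fin 2) → ℝ) (x : EuclideanSpace ℝ (Fin 2)) : ℝ :=
  fderiv ℝ f x (eb i)

/-- `f` is differentiable at `x` with `i`-th partial derivative `f'`. -/
def HasPd (i : Fin 2) (f : EuclideanSpace ℝ (Fin 2) → ℝ) (f' : ℝ)
    (x : EuclideanSpace ℝ (Fin 2)) : Prop :=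
  DifferentiableAt ℝ f x ∧ pd i f x = f'

namespace HasPd

variable {i : Fin 2} {f g : EuclideanSpace ℝ (Fin 2) → ℝ} {f' g' : ℝ}
  {x : EuclideanSpace ℝ (Fin 2)}

lemma add (hf : HasPd i f f' x) (hg : HasPd i g g' x) :
    HasPd i (fun y => f y + g y) (f' + g') x := by
  refine ⟨hf.1.add hg.1, ?_⟩
  rw [pd, fderiv_fun_add hf.1 hg.1, ← hf.2, ← hg.2]
  rfl

lemma sub (hf : HasPd i f f' x) (hg : HasPd i g g' x) :
    HasPd i (fun y => f y - g y) (f' - g') x := by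
  refine ⟨hf.1.sub hg.1, ?_⟩
  rw [pd, fderiv_fun_sub hf.1 hg.1, ← hf.2, ← hg.2]
  rfl

lemma mul (hf : HasPd i f f' x) (hg : HasPd i g g' x) :
    HasPd i (fun y => f y * g y) (f x * g' + g x * f') x := by
  refine ⟨hf.1.mul hg.1, ?_⟩
  rw [pd, fderiv_fun_mul hf.1 hg.1, ← hf.2, ← hg.2]
  rfl

lemma comp {F : ℝ → ℝ} {F' : ℝ} (hF : HasDerivAt F F' (f x)) (hf : HasPd i f f' x) :
    HasPd i (fun y => F (f y)) (F' * f') x := by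
  have := hF.comp_hasFDerivAt x hf.1.hasFDerivAt
  refine ⟨this.differentiableAt, ?_⟩
  rw [pd, ← hf.2]
  exact congrArg (fun L => L (eb i)) this.fderiv

lemma unique (h : HasPd i f f' x) (h' : HasPd i f g' x) : f' = g' := h.2.symm.trans h'.2

lemma congr (hf : HasPd i f f' x) (h : g =ᶠ[nhds x] f) : HasPd i g f' x :=
  ⟨hf.1.congr_of_eventuallyEq h, by rw [pd, h.fderiv_eq]; exact hf.2⟩

end HasPd

lemma DifferentiableAt.hasPd {f : EuclideanSpace ℝ (Fin 2) → ℝ} {x : EuclideanSpace ℝ (Fin 2)}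
    (hf : DifferentiableAt ℝ f x) (i : Fin 2) : HasPd i f (pd i f x) x := ⟨hf, rfl⟩

lemma ContDiffOn.pd {Ω : Set (EuclideanSpace ℝ (Fin 2))} (hΩ : IsOpen Ω)
    {f : EuclideanSpace ℝ (Fin 2) → ℝ} {m n : WithTop ℕ∞} (hf : ContDiffOn ℝ n f Ω)
    (hmn : m + 1 ≤ n) (i : Fin 2) : ContDiffOn ℝ m (pd i f) Ω :=
  (hf.fderiv_of_isOpen hΩ hmn).clm_apply contDiffOn_const

lemma pd_comm {f : EuclideanSpace ℝ (Fin 2) → ℝ} {x : EuclideanSpace ℝ (Fin 2)}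
    (hf : ContDiffAt ℝ 2 f x) (i j : Fin 2) : pd i (pd j f) x = pd j (pd i f) x := by
  have hd : DifferentiableAt ℝ (fderiv ℝ f) x :=
    (hf.fderiv_right (m := 1) (by norm_num)).differentiableAt (by norm_num)
  have key : ∀ a b : Fin 2, pd a (pd b f) x = fderiv ℝ (fderiv ℝ f) x (eb a) (eb b) := by
    intro a b
    change fderiv ℝ (fun y => fderiv ℝ f y (eb b)) x (eb a) = _
    rw [fderiv_clm_apply hd (differentiableAt_const _)]
    simp
  rw [key, key]
  exact hf.isSymmSndFDerivAt (by simp) _ _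

lemma norm_gradient_sq (u : EuclideanSpace ℝ (Fin 2) → ℝ) (x : EuclideanSpace ℝ (Fin 2)) :
    ‖gradient u x‖ ^ 2 = pd 0 u x ^ 2 + pd 1 u x ^ 2 := by
  have key : ∀ i : Fin 2, gradient u x i = pd i u x := by
    intro i
    have h : inner ℝ (gradient u x) (eb i) = fderiv ℝ u x (eb i) := by
      rw [gradient, InnerProductSpace.toDual_symm_apply]
    rw [pd, ← h, eb, real_inner_comm, EuclideanSpace.inner_single_left]
    simp
  rw [EuclideanSpace.norm_sq_eq, Fin.sum_univ_two, key, key]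
  simp

/-- The flux identity behind the `P`-function equation, where `X = D²u(∇u, ∇u)`. -/
lemma flux_identity {p r p0 p1 r1 q g g' h G ψ D m : ℝ} (hq : 0 < q) (hψ : 0 < ψ) (hg : 0 < g)
    (hG : 0 < G) (hD : 0 < D) (hqq : q ^ 2 = p ^ 2 + r ^ 2) (hGd : G = g + 2 * q ^ 2 * g')
    (hDd : D = ψ * h - g * q) (hm : m = ψ * G / D)
    (hpde : g * (p0 + r1) +
      2 * g' * (p * (p * p0 + r * p1) + r * (p * p1 + r * r1)) = h) :
    (D / (ψ * q ^ 4 * G) * r ^ 2 + D / (ψ * q ^ 4 * g) * p ^ 2) *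
        (m * (p * p0 + r * p1) - p) +
      (D / (ψ * q ^ 4 * g) - D / (ψ * q ^ 4 * G)) * (p * r) * (m * (p * p1 + r * r1) - r) =
    (r * p1 - p * r1) * (q ^ 2)⁻¹ + p * (q * ψ)⁻¹ := by
  have hmD : m * D = ψ * G := by rw [hm]; field_simp
  generalize he0 : p * p0 + r * p1 = e0 at *
  generalize he1 : p * p1 + r * r1 = e1 at *
  have h1 : (D / (ψ * q ^ 4 * G) * r ^ 2 + D / (ψ * q ^ 4 * g) * p ^ 2) * (m * e0 - p) +
      (D / (ψ * q ^ 4 * g) - D / (ψ * q ^ 4 * G)) * (p * r) * (m * e1 - r) =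
      (r * (r * e0 - p * e1)) * ((m * D) / (ψ * G)) / q ^ 4 +
      p * ((m * D) * (p * e0 + r * e1) - D * (p ^ 2 + r ^ 2)) / (ψ * g * q ^ 4) := by
    field_simp
    ring
  rw [h1, hmD, ← hqq, hDd]
  have h2 : G * (p * e0 + r * e1) - h * q ^ 2 = g * (p * e0 + r * e1 - q ^ 2 * (p0 + r1)) := by
    rw [hGd, ← hpde]; ring
  have h3 : p * (ψ * G * (p * e0 + r * e1) - (ψ * h - g * q) * q ^ 2) / (ψ * g * q ^ 4) =
      p * (p * e0 + r * e1 - q ^ 2 * (p0 + r1)) / q ^ 4 + p * (q * ψ)⁻¹ := by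
    have : ψ * G * (p * e0 + r * e1) - (ψ * h - g * q) * q ^ 2 =
        ψ * (G * (p * e0 + r * e1) - h * q ^ 2) + g * q ^ 3 := by ring
    rw [this, h2]
    field_simp
  rw [h3]
  have h4 : r * (r * e0 - p * e1) + p * (p * e0 + r * e1 - q ^ 2 * (p0 + r1)) =
      (r * p1 - p * r1) * q ^ 2 := by
    rw [hqq, ← he0, ← he1]; ring
  have h5 : r * (r * e0 - p * e1) = (r * p1 - p * r1) * q ^ 2 -
      p * (p * e0 + r * e1 - q ^ 2 * (p0 + r1)) := by linarith
  rw [h5]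
  field_simp
  ring

/-- The divergence of the flux in `flux_identity` is a multiple of `⟨∇u, ∇Φ⟩`. -/
lemma divergence_identity {p r p0 p1 r1 p01 p11 q g g' h G ψ D m c : ℝ}
    (hq : 0 < q) (hψ : 0 < ψ) (hg : 0 < g) (hG : 0 < G) (hD : 0 < D)
    (hqq : q ^ 2 = p ^ 2 + r ^ 2) (hGd : G = g + 2 * q ^ 2 * g')
    (hDd : D = ψ * h - g * q) (hm : m = ψ * G / D)
    (hpde : g * (p0 + r1) +
      2 * g' * (p * (p * p0 + r * p1) + r * (p * p1 + r * r1)) = h)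
    (hc : c = (-(ψ + q * m) / (q * ψ) ^ 2 / q - 2 * g' * (q * ψ)⁻¹ / g) / m) :
    ((r * p1 - p * r1) * (-2 / q ^ 3 * ((p * p0 + r * p1) / q)) +
        (q ^ 2)⁻¹ * ((r * p01 + p1 * p1) - (p * p11 + r1 * p0)) +
        (p * (-(ψ + q * m) / (q * ψ) ^ 2 * ((p * p0 + r * p1) / q)) + (q * ψ)⁻¹ * p0)) +
      ((p * p1 - r * p0) * (-2 / q ^ 3 * ((p * p1 + r * r1) / q)) +
        (q ^ 2)⁻¹ * ((p * p11 + p1 * p1) - (r * p01 + p0 * r1)) +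
        (r * (-(ψ + q * m) / (q * ψ) ^ 2 * ((p * p1 + r * r1) / q)) + (q * ψ)⁻¹ * r1)) =
    c * (p * (m * (p * p0 + r * p1) - p) + r * (m * (p * p1 + r * r1) - r)) := by
  have hm0 : 0 < m := by rw [hm]; positivity
  have hmD : m * D = ψ * G := by rw [hm]; field_simp
  have hcurl : ((r * p1 - p * r1) * (-2 / q ^ 3 * ((p * p0 + r * p1) / q)) +
        (q ^ 2)⁻¹ * ((r * p01 + p1 * p1) - (p * p11 + r1 * p0))) +
      ((p * p1 - r * p0) * (-2 / q ^ 3 * ((p * p1 + r * r1) / q)) +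
        (q ^ 2)⁻¹ * ((p * p11 + p1 * p1) - (r * p01 + p0 * r1))) = 0 := by
    field_simp
    rw [hqq]
    ring
  set X := p * (p * p0 + r * p1) + r * (p * p1 + r * r1) with hX
  have hlap : p0 + r1 = (h - 2 * g' * X) / g := by
    rw [eq_div_iff hg.ne']; linarith
  have hS : p * (m * (p * p0 + r * p1) - p) + r * (m * (p * p1 + r * r1) - r) = m * X - q ^ 2 := by
    rw [hqq, hX]; ring
  have hrad : (q * ψ)⁻¹ * h / g + q ^ 2 * c = 0 := by
    have hh : h = (D + g * q) / ψ := by rw [eq_div_iff hψ.ne']; linarith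
    have hg' : g' = (G - g) / (2 * q ^ 2) := by rw [eq_div_iff (by positivity)]; linarith
    have hD' : D = ψ * G / m := by rw [eq_div_iff hm0.ne']; linarith
    rw [hc, hh, hg', hD']
    field_simp
    ring
  have hcm : c * m = -(ψ + q * m) / (q * ψ) ^ 2 / q - 2 * g' * (q * ψ)⁻¹ / g := by
    rw [hc]; field_simp
  rw [hS]
  have hlap' : (q * ψ)⁻¹ * (p0 + r1) = (q * ψ)⁻¹ * h / g - 2 * g' * (q * ψ)⁻¹ / g * X := by
    rw [hlap]; ring
  linear_combination hcurl + hlap' + hrad - X * hcm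

lemma contDiffOn_inverse_deriv {g h ψ : ℝ → ℝ} (hg : Cond24 g) (hh : Cond25 h)
    (hD : ∀ s > 0, 0 < ψ s * h (s ^ 2) - g (s ^ 2) * s)
    (hψd : ∀ s > 0, HasDerivAt ψ
      (ψ s * Gfun g (s ^ 2) / (ψ s * h (s ^ 2) - g (s ^ 2) * s)) s) :
    ContDiffOn ℝ 1 (fun s => g (s ^ 2)) (Ioi 0) ∧
    ContDiffOn ℝ 1 (fun s => deriv g (s ^ 2)) (Ioi 0) ∧
    ContDiffOn ℝ 1 (fun s => Gfun g (s ^ 2)) (Ioi 0) ∧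
    ContDiffOn ℝ 1 (fun s => h (s ^ 2)) (Ioi 0) ∧ ContDiffOn ℝ 1 ψ (Ioi 0) ∧
    ContDiffOn ℝ 1 (fun s => ψ s * Gfun g (s ^ 2) / (ψ s * h (s ^ 2) - g (s ^ 2) * s))
      (Ioi 0) := by
  have hsq : ContDiffOn ℝ 1 (fun s : ℝ => s ^ 2) (Ioi 0) := by fun_prop
  have hmaps : MapsTo (fun s : ℝ => s ^ 2) (Ioi 0) (Ioi 0) :=
    fun s hs => (pow_pos hs 2 : (0 : ℝ) < s ^ 2)
  have hgs : ContDiffOn ℝ 1 (fun s => g (s ^ 2)) (Ioi 0) :=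
    (hg.1.of_le (by exact_mod_cast le_top)).comp hsq hmaps
  have hdgs : ContDiffOn ℝ 1 (fun s => deriv g (s ^ 2)) (Ioi 0) :=
    ((((contDiffOn_infty_iff_deriv_of_isOpen isOpen_Ioi).1 hg.1).2).of_le
      (by exact_mod_cast le_top)).comp hsq hmaps
  have hGs : ContDiffOn ℝ 1 (fun s => Gfun g (s ^ 2)) (Ioi 0) :=
    hgs.add ((contDiffOn_const.mul hsq).mul hdgs)
  have hhs : ContDiffOn ℝ 1 (fun s => h (s ^ 2)) (Ioi 0) :=
    (hh.1.of_le (by exact_mod_cast le_top)).comp hsq fun s _ => sq_nonneg s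
  have hm : ∀ n : WithTop ℕ∞, n ≤ 1 → ContDiffOn ℝ n ψ (Ioi 0) → ContDiffOn ℝ n
      (fun s => ψ s * Gfun g (s ^ 2) / (ψ s * h (s ^ 2) - g (s ^ 2) * s)) (Ioi 0) := by
    intro n hn hψ
    exact (hψ.mul (hGs.of_le hn)).div
      ((hψ.mul (hhs.of_le hn)).sub ((hgs.of_le hn).mul contDiffOn_id)) fun s hs => (hD s hs).ne'
  have hψ1 : ContDiffOn ℝ 1 ψ (Ioi 0) := by
    rw [show (1 : WithTop ℕ∞) = 0 + 1 from rfl, contDiffOn_succ_iff_deriv_of_isOpen isOpen_Ioi]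
    refine ⟨fun s hs => (hψd s hs).differentiableAt.differentiableWithinAt, by simp, ?_⟩
    refine (hm 0 (by simp) (contDiffOn_zero.2 fun s hs =>
      (hψd s hs).continuousAt.continuousWithinAt)).congr fun s hs => (hψd s hs).deriv
  exact ⟨hgs, hdgs, hGs, hhs, hψ1, hm 1 le_rfl hψ1⟩

/-- Paper's Theorem 2.2: in dimension `N = 2`, under the same assumptions as in
Theorem 2.1, the function `Φ = ∫₀^q s ψ'(s) ds − u` attains both its maximum and its
minimum over `closure Ω` on the boundary `∂Ω`. -/
theorem stmt8 (g h : ℝ → ℝ) (hg : Cond24 g) (hh : Cond25 h)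
    (t₀ : ℝ) (ht₀ : 0 ≤ t₀) (t₁ : EReal) (ht₁ : (t₀ : EReal) < t₁)
    (φ ψ : ℝ → ℝ)
    (hsol : SolOn 2 g h φ (Iint t₀ t₁))
    (hcont₀ : Tendsto φ (nhdsWithin t₀ (Ioi t₀)) (nhds 0))
    (hmono : StrictMonoOn φ (Iint t₀ t₁))
    (hrange : φ '' (Iint t₀ t₁) = Ioi 0)
    (hψl : ∀ t ∈ Iint t₀ t₁, ψ (φ t) = t)
    (hψr : ∀ s ∈ Ioi (0:ℝ), ψ s ∈ Iint t₀ t₁ ∧ φ (ψ s) = s)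
    (Ω : Set (EuclideanSpace ℝ (Fin 2))) (hΩ : IsOpen Ω)
    (hbdd : Bornology.IsBounded Ω) (hne : Ω.Nonempty)
    (u : EuclideanSpace ℝ (Fin 2) → ℝ) (hu : ContDiffOn ℝ 3 u Ω)
    (hucont : ContinuousOn u (closure Ω))
    -- `Gr` is the continuous extension of `∇u` to the closure of `Ω`
    (Gr : EuclideanSpace ℝ (Fin 2) → EuclideanSpace ℝ (Fin 2))
    (hGrcont : ContinuousOn Gr (closure Ω))
    (hGr : ∀ x ∈ Ω, Gr x = gradient u x)
    (hqpos : ∀ x ∈ closure Ω, 0 < ‖Gr x‖)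
    (hpde : ∀ x ∈ Ω,
      ∑ i, fderiv ℝ (fun y => g (‖gradient u y‖ ^ 2) * fderiv ℝ u y (eb i)) x (eb i)
        = h (‖gradient u x‖ ^ 2)) :
    (∃ x₀ ∈ frontier Ω, ∀ x ∈ closure Ω,
      (∫ s in (0:ℝ)..‖Gr x‖, s * deriv ψ s) - u x ≤
      (∫ s in (0:ℝ)..‖Gr x₀‖, s * deriv ψ s) - u x₀) ∧
    (∃ x₁ ∈ frontier Ω, ∀ x ∈ closure Ω,
      (∫ s in (0:ℝ)..‖Gr x₁‖, s * deriv ψ s) - u x₁ ≤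
      (∫ s in (0:ℝ)..‖Gr x‖, s * deriv ψ s) - u x) := by
  have hφpos : ∀ t ∈ Iint t₀ t₁, 0 < φ t := fun t ht => by
    have : φ t ∈ Ioi (0 : ℝ) := hrange ▸ mem_image_of_mem φ ht
    exact this
  have hflux : ∀ t ∈ Iint t₀ t₁, g (φ t ^ 2) * φ t < t * h (φ t ^ 2) :=
    fun t ht => flux_lt hg hh ht₀ hsol hcont₀ hmono hφpos ht
  have hψ0 : ∀ s > 0, 0 < ψ s := fun s hs => ht₀.trans_lt (hψr s hs).1.1
  have hD : ∀ s > 0, 0 < ψ s * h (s ^ 2) - g (s ^ 2) * s := fun s hs => by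
    have := hflux _ (hψr s hs).1
    rw [(hψr s hs).2] at this
    linarith
  have hψmono : MonotoneOn ψ (Ioi 0) := by
    intro a ha b hb hab
    rw [← hmono.le_iff_le (hψr a ha).1 (hψr b hb).1, (hψr a ha).2, (hψr b hb).2]
    exact hab
  have hψd : ∀ s > 0, HasDerivAt ψ
      (ψ s * Gfun g (s ^ 2) / (ψ s * h (s ^ 2) - g (s ^ 2) * s)) s := fun s hs =>
    hasDerivAt_inverse hg ht₀ hsol hψmono hψl hψr hφpos hflux hs
  obtain ⟨hgs, hdgs, hGs, hhs, hψC, hmC⟩ := contDiffOn_inverse_deriv hg hh hD hψd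
  have hgpos : ∀ s > 0, 0 < g (s ^ 2) := fun s hs => hg.2.1 _ (pow_pos hs 2)
  have hGpos : ∀ s > 0, 0 < Gfun g (s ^ 2) := fun s hs => hg.2.2.2.2 _ (pow_pos hs 2)
  set m : ℝ → ℝ := fun s => ψ s * Gfun g (s ^ 2) / (ψ s * h (s ^ 2) - g (s ^ 2) * s) with hm
  have hmpos : ∀ s > 0, 0 < m s := fun s hs =>
    div_pos (mul_pos (hψ0 s hs) (hGpos s hs)) (hD s hs)
  set I : ℝ → ℝ := fun r => ∫ s in (0 : ℝ)..r, s * deriv ψ s with hI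
  have hId : ∀ s > 0, HasDerivAt I (s * m s) s := fun s hs =>
    hasDerivAt_integral_mul_deriv (fun s hs => (hψr s hs).1.1.le) hψmono hψd hmC.continuousOn hs
  set A : ℝ → ℝ := fun s =>
    (ψ s * h (s ^ 2) - g (s ^ 2) * s) / (ψ s * s ^ 4 * Gfun g (s ^ 2)) with hA
  set B : ℝ → ℝ := fun s =>
    (ψ s * h (s ^ 2) - g (s ^ 2) * s) / (ψ s * s ^ 4 * g (s ^ 2)) with hB
  set c : ℝ → ℝ := fun s => (-(ψ s + s * m s) / (s * ψ s) ^ 2 / s -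
    2 * deriv g (s ^ 2) * (s * ψ s)⁻¹ / g (s ^ 2)) / m s with hc
  have hApos : ∀ s > 0, 0 < A s := fun s hs =>
    div_pos (hD s hs) (mul_pos (mul_pos (hψ0 s hs) (pow_pos hs 4)) (hGpos s hs))
  have hBpos : ∀ s > 0, 0 < B s := fun s hs =>
    div_pos (hD s hs) (mul_pos (mul_pos (hψ0 s hs) (pow_pos hs 4)) (hgpos s hs))
  have hidC : ContDiffOn ℝ 1 (fun s : ℝ => s) (Ioi 0) := contDiffOn_id
  have hAC : ContDiffOn ℝ 1 A (Ioi 0) :=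
    ((hψC.mul hhs).sub (hgs.mul hidC)).div ((hψC.mul (hidC.pow 4)).mul hGs) fun s hs =>
      (mul_pos (mul_pos (hψ0 s hs) (pow_pos hs 4)) (hGpos s hs)).ne'
  have hBC : ContDiffOn ℝ 1 B (Ioi 0) :=
    ((hψC.mul hhs).sub (hgs.mul hidC)).div ((hψC.mul (hidC.pow 4)).mul hgs) fun s hs =>
      (mul_pos (mul_pos (hψ0 s hs) (pow_pos hs 4)) (hgpos s hs)).ne'
  have hcC : ContinuousOn c (Ioi 0) := by
    have hsψ : ∀ s ∈ Ioi (0 : ℝ), s * ψ s ≠ 0 := fun s hs => (mul_pos hs (hψ0 s hs)).ne'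
    have hsψC := hidC.continuousOn.mul hψC.continuousOn
    exact (((((hψC.continuousOn.add (hidC.continuousOn.mul hmC.continuousOn)).neg).div
      (hsψC.pow 2) fun s hs => pow_ne_zero 2 (hsψ s hs)).div hidC.continuousOn
        fun s hs => ne_of_gt hs).sub
      (((continuousOn_const.mul hdgs.continuousOn).mul (hsψC.inv₀ hsψ)).div hgs.continuousOn
        fun s hs => (hgpos s hs).ne')).div hmC.continuousOn fun s hs => (hmpos s hs).ne'
  set q : EuclideanSpace ℝ (Fin 2) → ℝ := fun y => ‖gradient u y‖ with hq
  set p : EuclideanSpace ℝ (Fin 2) → ℝ := pd 0 u with hp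
  set r : EuclideanSpace ℝ (Fin 2) → ℝ := pd 1 u with hr
  have hqq : ∀ y, q y ^ 2 = p y ^ 2 + r y ^ 2 := norm_gradient_sq u
  have hqpos' : ∀ x ∈ Ω, 0 < q x := fun x hx => by
    have := hqpos x (subset_closure hx)
    rwa [hGr x hx] at this
  have hpC : ContDiffOn ℝ 2 p Ω := hu.pd hΩ (by norm_num) 0
  have hrC : ContDiffOn ℝ 2 r Ω := hu.pd hΩ (by norm_num) 1
  have hqC : ContDiffOn ℝ 2 q Ω := by
    have : ContDiffOn ℝ 2 (fun y => Real.sqrt (p y ^ 2 + r y ^ 2)) Ω := by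
      refine ((hpC.pow 2).add (hrC.pow 2)).sqrt fun x hx => ?_
      rw [← hqq]
      exact (pow_pos (hqpos' x hx) 2).ne'
    exact this.congr fun x _ => by rw [← hqq, Real.sqrt_sq (norm_nonneg _)]
  have hqC1 : ContDiffOn ℝ 1 q Ω := hqC.of_le (by norm_num)
  have hp1C : ∀ i, ContDiffOn ℝ 1 (pd i p) Ω := fun i => hpC.pd hΩ (by norm_num) i
  have hr1C : ∀ i, ContDiffOn ℝ 1 (pd i r) Ω := fun i => hrC.pd hΩ (by norm_num) i
  have diff : ∀ {f : EuclideanSpace ℝ (Fin 2) → ℝ} {n : WithTop ℕ∞} (_ : ContDiffOn ℝ n f Ω)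
      (_ : n ≠ 0) {x}, x ∈ Ω → DifferentiableAt ℝ f x := fun hf hn _ hx =>
    (hf.contDiffAt (hΩ.mem_nhds hx)).differentiableAt hn
  have hdu : ∀ {x}, x ∈ Ω → DifferentiableAt ℝ u x := diff hu (by norm_num)
  have hdp : ∀ {x}, x ∈ Ω → DifferentiableAt ℝ p x := diff hpC (by norm_num)
  have hdr : ∀ {x}, x ∈ Ω → DifferentiableAt ℝ r x := diff hrC (by norm_num)
  have hdq : ∀ {x}, x ∈ Ω → DifferentiableAt ℝ q x := diff hqC (by norm_num)
  have hdp1 : ∀ i {x}, x ∈ Ω → DifferentiableAt ℝ (pd i p) x := fun i => diff (hp1C i) (by norm_num)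
  have hdr1 : ∀ i {x}, x ∈ Ω → DifferentiableAt ℝ (pd i r) x := fun i => diff (hr1C i) (by norm_num)
  have hsymm : ∀ x ∈ Ω, pd 0 r x = pd 1 p x := fun x hx =>
    pd_comm ((hu.contDiffAt (hΩ.mem_nhds hx)).of_le (by norm_num)) 0 1
  have hnear : ∀ {f f' : EuclideanSpace ℝ (Fin 2) → ℝ} (_ : ∀ x ∈ Ω, f x = f' x) {x}, x ∈ Ω →
      f =ᶠ[nhds x] f' := fun hf x hx => by
    filter_upwards [hΩ.mem_nhds hx] with y hy using hf y hy
  have hqd : ∀ i, ∀ x ∈ Ω, pd i q x = (p x * pd i p x + r x * pd i r x) / q x := by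
    intro i x hx
    have h1 := ((hdq hx).hasPd i).mul ((hdq hx).hasPd i)
    have h2 := (((hdp hx).hasPd i).mul ((hdp hx).hasPd i)).add
      (((hdr hx).hasPd i).mul ((hdr hx).hasPd i))
    have h3 := h1.unique (h2.congr (Eventually.of_forall fun y => by
      have := hqq y
      simp only []
      linarith))
    rw [eq_div_iff (hqpos' x hx).ne']
    linarith
  -- the gradient of the `P`-function
  set φ0 : EuclideanSpace ℝ (Fin 2) → ℝ := fun x =>
    m (q x) * (p x * pd 0 p x + r x * pd 1 p x) - p x with hφ0
  set φ1 : EuclideanSpace ℝ (Fin 2) → ℝ := fun x =>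
    m (q x) * (p x * pd 1 p x + r x * pd 1 r x) - r x with hφ1
  set Φ : EuclideanSpace ℝ (Fin 2) → ℝ := fun x => I ‖Gr x‖ - u x with hΦ
  have hΦq : ∀ x ∈ Ω, Φ x = I (q x) - u x := fun x hx => by simp only [hΦ, hq, hGr x hx]
  have hΦpd : ∀ i, ∀ x ∈ Ω,
      HasPd i Φ (m (q x) * (p x * pd i p x + r x * pd i r x) - pd i u x) x := by
    intro i x hx
    have h1 := ((HasPd.comp (hId _ (hqpos' x hx)) ((hdq hx).hasPd i)).sub
      ((hdu hx).hasPd i)).congr (hnear hΦq hx)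
    rw [hqd i x hx] at h1
    refine ⟨h1.1, h1.2.trans ?_⟩
    have := (hqpos' x hx).ne'
    field_simp
  have hΦ0 : ∀ x ∈ Ω, pd 0 Φ x = φ0 x := fun x hx => by
    rw [(hΦpd 0 x hx).2, hsymm x hx]
  have hΦ1 : ∀ x ∈ Ω, pd 1 Φ x = φ1 x := fun x hx => (hΦpd 1 x hx).2
  have hmapsq : MapsTo q Ω (Ioi 0) := hqpos'
  have hpC1 : ContDiffOn ℝ 1 p Ω := hpC.of_le (by norm_num)
  have hrC1 : ContDiffOn ℝ 1 r Ω := hrC.of_le (by norm_num)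
  have hmq := hmC.comp hqC1 hmapsq
  have hAq := hAC.comp hqC1 hmapsq
  have hBq := hBC.comp hqC1 hmapsq
  have hφ0C : ContDiffOn ℝ 1 φ0 Ω :=
    (hmq.mul ((hpC1.mul (hp1C 0)).add (hrC1.mul (hp1C 1)))).sub hpC1
  have hφ1C : ContDiffOn ℝ 1 φ1 Ω :=
    (hmq.mul ((hpC1.mul (hp1C 1)).add (hrC1.mul (hr1C 1)))).sub hrC1
  have hdφ0 : ∀ {x}, x ∈ Ω → DifferentiableAt ℝ φ0 x := diff hφ0C (by norm_num)
  have hdφ1 : ∀ {x}, x ∈ Ω → DifferentiableAt ℝ φ1 x := diff hφ1C (by norm_num)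
  -- the coefficient matrix
  set M00 : EuclideanSpace ℝ (Fin 2) → ℝ := fun x => A (q x) * r x ^ 2 + B (q x) * p x ^ 2
    with hM00
  set M01 : EuclideanSpace ℝ (Fin 2) → ℝ := fun x => (B (q x) - A (q x)) * (p x * r x) with hM01
  set M11 : EuclideanSpace ℝ (Fin 2) → ℝ := fun x => A (q x) * p x ^ 2 + B (q x) * r x ^ 2
    with hM11
  have hM00C : ContDiffOn ℝ 1 M00 Ω := (hAq.mul (hrC1.pow 2)).add (hBq.mul (hpC1.pow 2))
  have hM01C : ContDiffOn ℝ 1 M01 Ω := (hBq.sub hAq).mul (hpC1.mul hrC1)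
  have hM11C : ContDiffOn ℝ 1 M11 Ω := (hAq.mul (hpC1.pow 2)).add (hBq.mul (hrC1.pow 2))
  have hsum : ∀ x ∈ Ω, 0 < p x ^ 2 + r x ^ 2 := fun x hx => by
    rw [← hqq]; exact pow_pos (hqpos' x hx) 2
  have hM00pos : ∀ x ∈ Ω, 0 < M00 x := by
    intro x hx
    have ha := hApos _ (hqpos' x hx)
    have hb := hBpos _ (hqpos' x hx)
    rcases eq_or_ne (p x) 0 with h0 | h0
    · have hr0 : 0 < r x ^ 2 := by have := hsum x hx; rw [h0] at this; linarith
      have : 0 ≤ B (q x) * p x ^ 2 := by positivity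
      have : 0 < A (q x) * r x ^ 2 := by positivity
      simp only [hM00]; linarith
    · have : 0 < B (q x) * p x ^ 2 := by positivity
      have : 0 ≤ A (q x) * r x ^ 2 := by positivity
      simp only [hM00]; linarith
  have hdet : ∀ x ∈ Ω, 0 ≤ M00 x * M11 x - M01 x ^ 2 := by
    intro x hx
    have ha := hApos _ (hqpos' x hx)
    have hb := hBpos _ (hqpos' x hx)
    have : M00 x * M11 x - M01 x ^ 2 = A (q x) * B (q x) * (p x ^ 2 + r x ^ 2) ^ 2 := by
      simp only [hM00, hM01, hM11]; ring
    rw [this]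
    positivity
  have hpde' : ∀ x ∈ Ω, g (q x ^ 2) * (pd 0 p x + pd 1 r x) + 2 * deriv g (q x ^ 2) *
      (p x * (p x * pd 0 p x + r x * pd 1 p x) + r x * (p x * pd 1 p x + r x * pd 1 r x)) =
      h (q x ^ 2) := by
    intro x hx
    have hgd : HasDerivAt (fun s => g (s ^ 2)) (deriv g (q x ^ 2) * (2 * q x)) (q x) := by
      have hd : HasDerivAt g (deriv g (q x ^ 2)) (q x ^ 2) :=
        ((hg.1.contDiffAt (Ioi_mem_nhds (pow_pos (hqpos' x hx) 2))).differentiableAt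
          (by simp)).hasDerivAt
      exact HasDerivAt.comp (h₂ := g) (h := fun s => s ^ 2) (q x) hd
        (by simpa using hasDerivAt_pow 2 (q x))
    have h0 := (HasPd.comp hgd ((hdq hx).hasPd 0)).mul ((hdp hx).hasPd 0)
    have h1 := (HasPd.comp hgd ((hdq hx).hasPd 1)).mul ((hdr hx).hasPd 1)
    have h2 := hpde x hx
    rw [Fin.sum_univ_two] at h2
    have h3 := congrArg₂ (· + ·) h0.2 h1.2
    have h4 := h3.symm.trans h2
    rw [← h4, hqd 0 x hx, hqd 1 x hx, hsymm x hx]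
    have := (hqpos' x hx).ne'
    field_simp
    ring
  have hGd : ∀ s : ℝ, Gfun g (s ^ 2) = g (s ^ 2) + 2 * s ^ 2 * deriv g (s ^ 2) := fun s => rfl
  -- the flux
  set Y0 : EuclideanSpace ℝ (Fin 2) → ℝ := fun x =>
    (r x * pd 1 p x - p x * pd 1 r x) * (q x ^ 2)⁻¹ + p x * (q x * ψ (q x))⁻¹ with hY0
  set Y1 : EuclideanSpace ℝ (Fin 2) → ℝ := fun x =>
    (p x * pd 1 p x - r x * pd 0 p x) * (q x ^ 2)⁻¹ + r x * (q x * ψ (q x))⁻¹ with hY1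
  have hY0eq : ∀ x ∈ Ω, Y0 x = M00 x * φ0 x + M01 x * φ1 x := by
    intro x hx
    have hs := hqpos' x hx
    exact (flux_identity hs (hψ0 _ hs) (hgpos _ hs) (hGpos _ hs) (hD _ hs) (hqq x) (hGd _) rfl rfl
      (hpde' x hx)).symm
  have hY1eq : ∀ x ∈ Ω, Y1 x = M01 x * φ0 x + M11 x * φ1 x := by
    intro x hx
    have hs := hqpos' x hx
    have := flux_identity (p := r x) (r := p x) (p0 := pd 1 r x) (p1 := pd 1 p x)
      (r1 := pd 0 p x) hs (hψ0 _ hs) (hgpos _ hs) (hGpos _ hs) (hD _ hs)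
      ((hqq x).trans (add_comm _ _)) (hGd _) rfl rfl (by rw [← hpde' x hx]; ring)
    simp only [hY1, hM01, hM11, hφ0, hφ1, hA, hB, hm]
    rw [← this]
    ring
  have hdiv : ∀ x ∈ Ω, pd 0 Y0 x + pd 1 Y1 x = c (q x) * (p x * φ0 x + r x * φ1 x) := by
    intro x hx
    have hs := hqpos' x hx
    have hι : HasDerivAt (fun s : ℝ => (s ^ 2)⁻¹) (-2 / q x ^ 3) (q x) := by
      refine ((hasDerivAt_pow 2 (q x)).inv (pow_ne_zero 2 hs.ne')).congr_deriv ?_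
      field_simp
      simp [mul_comm]
    have hk : HasDerivAt (fun s => (s * ψ s)⁻¹)
        (-(ψ (q x) + q x * m (q x)) / (q x * ψ (q x)) ^ 2) (q x) := by
      refine (((hasDerivAt_id' (q x)).mul (hψd _ hs)).inv
        (mul_pos hs (hψ0 _ hs)).ne').congr_deriv ?_
      simp [hm]
    have P := fun i => (hdp hx).hasPd i
    have R := fun i => (hdr hx).hasPd i
    have Q := fun i => (hdq hx).hasPd i
    have h0 := ((((R 0).mul ((hdp1 1 hx).hasPd 0)).sub ((P 0).mul ((hdr1 1 hx).hasPd 0))).mul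
      (HasPd.comp hι (Q 0))).add ((P 0).mul (HasPd.comp hk (Q 0)))
    have h1 := ((((P 1).mul ((hdp1 1 hx).hasPd 1)).sub ((R 1).mul ((hdp1 0 hx).hasPd 1))).mul
      (HasPd.comp hι (Q 1))).add ((R 1).mul (HasPd.comp hk (Q 1)))
    have hsp : pd 1 (pd 0 p) x = pd 0 (pd 1 p) x :=
      pd_comm (hpC.contDiffAt (hΩ.mem_nhds hx)) 1 0
    have hsr : pd 0 (pd 1 r) x = pd 1 (pd 1 p) x := by
      rw [pd_comm (hrC.contDiffAt (hΩ.mem_nhds hx)) 0 1]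
      exact (((hdp1 1 hx).hasPd 1).congr (hnear hsymm hx)).2
    have key := divergence_identity (p01 := pd 0 (pd 1 p) x)
      (p11 := pd 1 (pd 1 p) x) hs (hψ0 _ hs) (hgpos _ hs) (hGpos _ hs)
      (hD _ hs) (hqq x) (hGd _) rfl rfl (hpde' x hx) rfl
    refine (congrArg₂ (· + ·) h0.2 h1.2).trans (Eq.trans ?_ key)
    rw [hqd 0 x hx, hqd 1 x hx, hsymm x hx, hsp, hsr]
  set d : EuclideanSpace ℝ (Fin 2) → ℝ := fun x => c (q x) * p x - (pd 0 M00 x + pd 1 M01 x)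
    with hd
  set e : EuclideanSpace ℝ (Fin 2) → ℝ := fun x => c (q x) * r x - (pd 0 M01 x + pd 1 M11 x)
    with he
  have hdC : ContinuousOn d Ω := by
    refine ((hcC.comp hqC.continuousOn hmapsq).mul hpC.continuousOn).sub ?_
    exact (hM00C.pd (m := 0) hΩ (by norm_num) 0).continuousOn.add
      (hM01C.pd (m := 0) hΩ (by norm_num) 1).continuousOn
  have heq : ∀ x ∈ Ω, M00 x * pd 0 φ0 x + M01 x * (pd 0 φ1 x + pd 1 φ0 x) + M11 x * pd 1 φ1 x =
      d x * φ0 x + e x * φ1 x := by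
    intro x hx
    have F0 := fun i => (hdφ0 hx).hasPd i
    have F1 := fun i => (hdφ1 hx).hasPd i
    have h00 := (diff hM00C (by norm_num) hx).hasPd 0
    have h01 := fun i => (diff hM01C (by norm_num) hx).hasPd i
    have h11 := (diff hM11C (by norm_num) hx).hasPd 1
    have h0 := ((h00.mul (F0 0)).add ((h01 0).mul (F1 0))).congr (hnear hY0eq hx)
    have h1 := (((h01 1).mul (F0 1)).add (h11.mul (F1 1))).congr (hnear hY1eq hx)
    have := hdiv x hx
    rw [h0.2, h1.2] at this
    simp only [hd, he]
    linarith
  have hΦc : ContinuousOn Φ (closure Ω) := by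
    refine ContinuousOn.sub (fun x hx => ?_) hucont
    exact (hId _ (hqpos x hx)).continuousAt.comp_continuousWithinAt (f := fun x => ‖Gr x‖)
      (hGrcont.norm x hx)
  refine ⟨exists_frontier_isMaxOn hΩ hbdd hne hΦc (fun x hx => (hΦpd 0 x hx).1) hΦ0 hΦ1
    (fun x => hdφ0) (fun x => hdφ1) hM00pos hdet hM00C.continuousOn hdC heq, ?_⟩
  have hneg : ∀ (i : Fin 2) (f : EuclideanSpace ℝ (Fin 2) → ℝ) (x : EuclideanSpace ℝ (Fin 2)),
      fderiv ℝ (fun y => -f y) x (eb i) = -pd i f x := fun i f x => by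
    rw [fderiv_fun_neg]; rfl
  obtain ⟨x₁, hx₁, hmin⟩ := exists_frontier_isMaxOn (e := e) hΩ hbdd hne hΦc.neg
    (fun x hx => (hΦpd 0 x hx).1.neg)
    (fun x hx => (hneg 0 Φ x).trans (congrArg _ (hΦ0 x hx)))
    (fun x hx => (hneg 1 Φ x).trans (congrArg _ (hΦ1 x hx)))
    (fun x hx => (hdφ0 hx).neg) (fun x hx => (hdφ1 hx).neg)
    hM00pos hdet hM00C.continuousOn hdC (fun x hx => by
      rw [hneg, hneg, hneg, hneg]
      linarith [heq x hx])
  exact ⟨x₁, hx₁, fun x hx => neg_le_neg_iff.1 (hmin x hx)⟩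

end
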